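/- arXiv:1010.3681 — 7 statements merged into one kernel-verified Lean document; each statement's English description precedes it below -/
import Mathlib

section
/- Let f_N : ℝ^k → ℝ (N ∈ ℕ) be continuous convex functions and let f : ℝ^k → ℝ be continuous and strictly convex, attaining its global minimum at the point x₀. Assume f_N → f uniformly on every compact subset of ℝ^k. Then there exists N₀ such that for every N ≥ N₀ the function f_N attains a global minimum, and the minimizers converge to x₀: for every ε > 0 there is N₁ such that for all N ≥ N₁, every global minimizer x_N of f_N satisfies ‖x_N − x₀‖ < ε. -/
/-- continuous convex functions converging uniformly on compacts to a continuous
strictly convex function with global minimum at `x₀` eventually attain global minima, and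
all their global minimizers converge to `x₀`. -/
theorem stmt4 {k : ℕ} (f : ℕ → EuclideanSpace ℝ (Fin k) → ℝ)
    (g : EuclideanSpace ℝ (Fin k) → ℝ)
    (hfcont : ∀ N, Continuous (f N)) (hfconv : ∀ N, ConvexOn ℝ Set.univ (f N))
    (hgcont : Continuous g) (hgconv : StrictConvexOn ℝ Set.univ g)
    (x₀ : EuclideanSpace ℝ (Fin k)) (hmin : ∀ y, g x₀ ≤ g y)
    (hunif : ∀ K : Set (EuclideanSpace ℝ (Fin k)), IsCompact K →
      TendstoUniformlyOn f g Filter.atTop K) :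
    (∃ N₀ : ℕ, ∀ N : ℕ, N₀ ≤ N → ∃ x, ∀ y, f N x ≤ f N y) ∧
    (∀ ε : ℝ, 0 < ε → ∃ N₁ : ℕ, ∀ N : ℕ, N₁ ≤ N →
      ∀ x, (∀ y, f N x ≤ f N y) → ‖x - x₀‖ < ε) := by
  have key : ∀ ε : ℝ, 0 < ε → ∃ N₁ : ℕ, ∀ N : ℕ, N₁ ≤ N →
      ∀ x, ε ≤ ‖x - x₀‖ → f N x₀ < f N x := by
    intro ε hε
    have hδ : ∃ δ : ℝ, 0 < δ ∧ ∀ z ∈ Metric.sphere x₀ ε, g x₀ + δ ≤ g z := by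
      rcases (Metric.sphere x₀ ε).eq_empty_or_nonempty with h | h
      · exact ⟨1, one_pos, by simp [h]⟩
      · obtain ⟨w, hw, hwmin⟩ := (isCompact_sphere x₀ ε).exists_isMinOn h hgcont.continuousOn
        have hne : x₀ ≠ w := by
          rintro rfl
          simp at hw
          linarith
        have hlt : g x₀ < g w := by
          have h1 := hgconv.2 (Set.mem_univ x₀) (Set.mem_univ w) hne
            (show (0:ℝ) < 1/2 by norm_num) (show (0:ℝ) < 1/2 by norm_num) (by norm_num)
          have h2 := hmin ((1/2:ℝ) • x₀ + (1/2:ℝ) • w)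
          simp only [smul_eq_mul] at h1
          linarith
        refine ⟨g w - g x₀, by linarith, fun z hz => ?_⟩
        have : g w ≤ g z := hwmin hz
        linarith
    obtain ⟨δ, hδ0, hδ⟩ := hδ
    have hu := Metric.tendstoUniformlyOn_iff.1
      (hunif _ (isCompact_closedBall x₀ ε)) (δ/2) (by linarith)
    obtain ⟨N₁, hN₁⟩ := Filter.eventually_atTop.1 hu
    refine ⟨N₁, fun N hN x hx => ?_⟩
    have hpos : 0 < ‖x - x₀‖ := lt_of_lt_of_le hε hx
    set t : ℝ := ε / ‖x - x₀‖ with ht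
    have ht0 : 0 < t := div_pos hε hpos
    have ht1 : t ≤ 1 := (div_le_one hpos).2 hx
    have hz : (1 - t) • x₀ + t • x ∈ Metric.sphere x₀ ε := by
      have : (1 - t) • x₀ + t • x - x₀ = t • (x - x₀) := by module
      rw [mem_sphere_iff_norm, this, norm_smul, Real.norm_of_nonneg ht0.le, ht]
      field_simp
    have h1 := (hfconv N).2 (Set.mem_univ x₀) (Set.mem_univ x)
      (show 0 ≤ 1 - t by linarith) ht0.le (by ring)
    simp only [smul_eq_mul] at h1
    have h2 := hN₁ N hN _ (Metric.sphere_subset_closedBall hz)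
    have h3 := hN₁ N hN x₀ (Metric.mem_closedBall_self hε.le)
    rw [Real.dist_eq, abs_lt] at h2 h3
    have h4 := hδ _ hz
    have h5 : 0 < t * (f N x - f N x₀) := by linarith [h2.1, h2.2, h3.1, h3.2]
    have := (mul_pos_iff_of_pos_left ht0).1 h5
    linarith
  refine ⟨?_, ?_⟩
  · obtain ⟨N₀, hN₀⟩ := key 1 one_pos
    refine ⟨N₀, fun N hN => ?_⟩
    have hx₀ : x₀ ∈ Metric.closedBall x₀ 1 := Metric.mem_closedBall_self zero_le_one
    obtain ⟨w, -, hwmin⟩ := (isCompact_closedBall x₀ 1).exists_isMinOn ⟨x₀, hx₀⟩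
      (hfcont N).continuousOn
    refine ⟨w, fun y => ?_⟩
    rcases le_total ‖y - x₀‖ 1 with h | h
    · exact hwmin (mem_closedBall_iff_norm.2 h)
    · exact le_trans (hwmin hx₀) (hN₀ N hN y h).le
  · intro ε hε
    obtain ⟨N₁, hN₁⟩ := key ε hε
    refine ⟨N₁, fun N hN x hx => ?_⟩
    by_contra hcon
    exact absurd (hx x₀) (not_le.2 (hN₁ N hN x (not_lt.1 hcon)))
end

section
/- Let f_N : ℝ^k → ℝ (N ∈ ℕ) be continuous convex functions and let f : ℝ^k → ℝ be continuous and strictly convex, attaining its global minimum at the point x₀ with f(x₀) = 0. Assume f_N → f uniformly on every compact subset of ℝ^k. Then for every open neighborhood U of x₀ there exist ε > 0 and N₀ such that f_N(x) > ε for all N ≥ N₀ and all x ∉ U. -/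
/-- Localization: continuous convex functions converging uniformly on compacts
to a continuous strictly convex function with global minimum value `0` at `x₀` are eventually
bounded below by some `ε > 0` outside any neighborhood `U` of `x₀`. -/
theorem stmt5 {k : ℕ} (f : ℕ → EuclideanSpace ℝ (Fin k) → ℝ)
    (g : EuclideanSpace ℝ (Fin k) → ℝ)
    (hfcont : ∀ N, Continuous (f N)) (hfconv : ∀ N, ConvexOn ℝ Set.univ (f N))
    (hgcont : Continuous g) (hgconv : StrictConvexOn ℝ Set.univ g)
    (x₀ : EuclideanSpace ℝ (Fin k)) (hmin : ∀ y, g x₀ ≤ g y) (hval : g x₀ = 0)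
    (hunif : ∀ K : Set (EuclideanSpace ℝ (Fin k)), IsCompact K →
      TendstoUniformlyOn f g Filter.atTop K) :
    ∀ U : Set (EuclideanSpace ℝ (Fin k)), IsOpen U → x₀ ∈ U →
      ∃ ε : ℝ, 0 < ε ∧ ∃ N₀ : ℕ, ∀ N : ℕ, N₀ ≤ N → ∀ x ∉ U, ε < f N x := by
  intro U hU hx₀
  obtain ⟨r, hr, hrU⟩ := Metric.isOpen_iff.1 hU x₀ hx₀
  have hpos : ∀ y, y ≠ x₀ → 0 < g y := by
    intro y hy
    have h := hgconv.2 (Set.mem_univ y) (Set.mem_univ x₀) hy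
      (by norm_num : (0 : ℝ) < 1 / 2) (by norm_num : (0 : ℝ) < 1 / 2) (by norm_num)
    have h2 := hmin ((1 / 2 : ℝ) • y + (1 / 2 : ℝ) • x₀)
    simp only [smul_eq_mul] at h
    linarith
  have hm : ∃ m : ℝ, 0 < m ∧ ∀ y ∈ Metric.sphere x₀ r, m ≤ g y := by
    rcases (Metric.sphere x₀ r).eq_empty_or_nonempty with he | hne
    · exact ⟨1, one_pos, by simp [he]⟩
    · obtain ⟨z, hz, hzmin⟩ := (isCompact_sphere x₀ r).exists_isMinOn hne hgcont.continuousOn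
      refine ⟨g z, hpos z ?_, fun y hy => hzmin hy⟩
      exact Metric.ne_of_mem_sphere hz hr.ne'
  obtain ⟨m, hm, hmS⟩ := hm
  have hu := Metric.tendstoUniformlyOn_iff.1
    (hunif _ (isCompact_closedBall x₀ r)) (m / 4) (by positivity)
  obtain ⟨N₀, hN₀⟩ := Filter.eventually_atTop.1 hu
  refine ⟨m / 4, by positivity, N₀, fun N hN x hx => ?_⟩
  have hd : r ≤ ‖x - x₀‖ := by
    by_contra hlt
    exact hx (hrU (by rw [Metric.mem_ball, dist_eq_norm]; exact not_le.1 hlt))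
  have hd0 : 0 < ‖x - x₀‖ := hr.trans_le hd
  obtain ⟨t, ht⟩ : ∃ t, t = r / ‖x - x₀‖ := ⟨_, rfl⟩
  have ht0 : 0 < t := by rw [ht]; positivity
  have ht1 : t ≤ 1 := by rw [ht]; exact (div_le_one hd0).2 hd
  have hyS : (1 - t) • x₀ + t • x ∈ Metric.sphere x₀ r := by
    have e : (1 - t) • x₀ + t • x - x₀ = t • (x - x₀) := by module
    rw [mem_sphere_iff_norm, e, norm_smul, Real.norm_of_nonneg ht0.le, ht]
    field_simp
  have h1 := hN₀ N hN _ (Metric.sphere_subset_closedBall hyS)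
  have h2 := hN₀ N hN x₀ (Metric.mem_closedBall_self hr.le)
  have h3 := hmS _ hyS
  have h4 := (hfconv N).2 (Set.mem_univ x₀) (Set.mem_univ x)
    (sub_nonneg.2 ht1) ht0.le (by ring)
  simp only [smul_eq_mul] at h4
  rw [Real.dist_eq, abs_lt] at h1 h2
  by_contra hcon
  have hcon := not_lt.1 hcon
  have h5 : (1 - t) * f N x₀ ≤ (1 - t) * (m / 4) :=
    mul_le_mul_of_nonneg_left (by linarith) (sub_nonneg.2 ht1)
  have h6 : t * f N x ≤ t * (m / 4) := mul_le_mul_of_nonneg_left hcon ht0.le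
  linarith
end

section
/- Let α ∈ ℝ with α > −1 and let j ∈ ℕ. Then there exists a monic polynomial P of degree j with real coefficients such that for every t > 0, ∫₀^∞ e^{−t·s} s^α (log s)^j ds = (−1)^j · Γ(α+1) · P(log t) · t^{−(α+1)}, where Γ is the Gamma function. -/
theorem logGamma_integrable (k : ℕ) : ∀ α : ℝ, -1 < α →
    MeasureTheory.IntegrableOn (fun u : ℝ => Real.exp (-u) * u ^ α * (Real.log u) ^ k)
      (Set.Ioi 0) := by
  induction k with
  | zero =>
    intro α hα
    have h := Real.GammaIntegral_convergent (s := α + 1) (by linarith)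
    simpa using h
  | succ k ih =>
    intro α hα
    have he : 0 < (α + 1) / 2 := by linarith
    set ε := (α + 1) / 2 with hε
    have h1 := (ih (α + ε) (by linarith)).norm
    have h2 := (ih (α + -ε) (by linarith)).norm
    refine MeasureTheory.Integrable.mono' ((h1.add h2).const_mul (1 / ε)) ?_ ?_
    · exact (by fun_prop : Measurable _).aestronglyMeasurable
    · refine (MeasureTheory.ae_restrict_iff' measurableSet_Ioi).2 (Filter.Eventually.of_forall ?_)
      intro u hu
      have hu : 0 < u := hu
      have a1 : Real.log u ≤ u ^ ε / ε := Real.log_le_rpow_div hu.le he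
      have a2 : Real.log u⁻¹ ≤ u⁻¹ ^ ε / ε := Real.log_le_rpow_div (inv_pos.2 hu).le he
      rw [Real.log_inv, Real.inv_rpow hu.le, ← Real.rpow_neg hu.le] at a2
      have p1 : 0 < u ^ ε / ε := by positivity
      have p2 : 0 < u ^ (-ε) / ε := by positivity
      have a3 : |Real.log u| ≤ 1 / ε * (u ^ ε + u ^ (-ε)) := by
        have e : 1 / ε * (u ^ ε + u ^ (-ε)) = u ^ ε / ε + u ^ (-ε) / ε := by ring
        rw [e, abs_le]
        constructor <;> linarith
      have hx : |u ^ α| = u ^ α := abs_of_pos (by positivity)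
      have hy : |u ^ ε| = u ^ ε := abs_of_pos (by positivity)
      have hz : |u ^ (-ε)| = u ^ (-ε) := abs_of_pos (by positivity)
      simp only [Pi.add_apply, norm_mul, norm_pow, Real.norm_eq_abs, Real.abs_exp,
        Real.rpow_add hu, abs_mul, hx, hy, hz]
      calc Real.exp (-u) * u ^ α * |Real.log u| ^ (k + 1)
          = Real.exp (-u) * u ^ α * |Real.log u| ^ k * |Real.log u| := by ring
        _ ≤ Real.exp (-u) * u ^ α * |Real.log u| ^ k * (1 / ε * (u ^ ε + u ^ (-ε))) := by gcongr
        _ = _ := by ring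

/-- for `α > -1` and `j ∈ ℕ` there is a monic polynomial `P` of degree `j` with
`∫₀^∞ e^{-ts} s^α (log s)^j ds = (-1)^j Γ(α+1) P(log t) t^{-(α+1)}` for all `t > 0`. -/
theorem stmt7 (α : ℝ) (hα : -1 < α) (j : ℕ) :
    ∃ P : Polynomial ℝ, P.Monic ∧ P.natDegree = j ∧
      ∀ t : ℝ, 0 < t →
        (∫ s in Set.Ioi (0:ℝ), Real.exp (-(t * s)) * s ^ α * (Real.log s) ^ j) =
          (-1 : ℝ) ^ j * Real.Gamma (α + 1) * Polynomial.eval (Real.log t) P *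
            t ^ (-(α + 1)) := by
  have hG : Real.Gamma (α + 1) ≠ 0 := (Real.Gamma_pos_of_pos (by linarith)).ne'
  set M : ℕ → ℝ := fun k => ∫ u in Set.Ioi (0:ℝ), Real.exp (-u) * u ^ α * (Real.log u) ^ k
    with hM
  have hM0 : M 0 = Real.Gamma (α + 1) := by
    rw [Real.Gamma_eq_integral (by linarith)]
    simp [hM]
  set P : Polynomial ℝ := ∑ m ∈ Finset.range (j + 1),
    Polynomial.C ((-1) ^ (j + m) * (j.choose m : ℝ) * M (j - m) / Real.Gamma (α + 1)) *
      Polynomial.X ^ m with hP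
  have hdeg : P.natDegree ≤ j := by
    refine Polynomial.natDegree_sum_le_of_forall_le _ _ fun m hm => ?_
    exact (Polynomial.natDegree_C_mul_X_pow_le _ _).trans
      (Nat.lt_succ_iff.1 (Finset.mem_range.1 hm))
  have hcoeff : P.coeff j = 1 := by
    rw [hP, Polynomial.finsetSum_coeff]
    simp only [Polynomial.coeff_C_mul_X_pow]
    rw [Finset.sum_ite_eq, if_pos (by simp)]
    simp [hM0, hG, ← two_mul]
  refine ⟨P, Polynomial.monic_of_natDegree_le_of_coeff_eq_one j hdeg hcoeff,
    le_antisymm hdeg (Polynomial.le_natDegree_of_ne_zero (by rw [hcoeff]; exact one_ne_zero)), ?_⟩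
  intro t ht
  have hsub := MeasureTheory.integral_comp_mul_left_Ioi
    (fun u : ℝ => t ^ (-α) * (Real.exp (-u) * u ^ α * (Real.log u - Real.log t) ^ j)) 0 ht
  have hL : (∫ s in Set.Ioi (0:ℝ), Real.exp (-(t * s)) * s ^ α * (Real.log s) ^ j) =
      ∫ s in Set.Ioi (0:ℝ), t ^ (-α) * (Real.exp (-(t * s)) * (t * s) ^ α *
        (Real.log (t * s) - Real.log t) ^ j) := by
    refine MeasureTheory.setIntegral_congr_fun measurableSet_Ioi fun s hs => ?_
    have hs : 0 < s := hs
    have h1 : t ^ (-α) * t ^ α = 1 := by rw [← Real.rpow_add ht]; simp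
    rw [Real.log_mul ht.ne' hs.ne', Real.mul_rpow ht.le hs.le, add_sub_cancel_left]
    linear_combination (-(Real.exp (-(t * s)) * s ^ α * Real.log s ^ j)) * h1
  have hE : (∫ u in Set.Ioi (0:ℝ), Real.exp (-u) * u ^ α * (Real.log u - Real.log t) ^ j) =
      ∑ m ∈ Finset.range (j + 1), ((-Real.log t) ^ m * (j.choose m : ℝ)) * M (j - m) := by
    have : ∀ u : ℝ, Real.exp (-u) * u ^ α * (Real.log u - Real.log t) ^ j =
        ∑ m ∈ Finset.range (j + 1), ((-Real.log t) ^ m * (j.choose m : ℝ)) *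
          (Real.exp (-u) * u ^ α * (Real.log u) ^ (j - m)) := by
      intro u
      rw [sub_eq_neg_add, add_pow, Finset.mul_sum]
      exact Finset.sum_congr rfl fun m _ => by ring
    simp only [this]
    rw [MeasureTheory.integral_finsetSum _
      fun m _ => (logGamma_integrable (j - m) α hα).const_mul _]
    exact Finset.sum_congr rfl fun m _ => MeasureTheory.integral_const_mul _ _
  rw [hL, hsub, mul_zero, MeasureTheory.integral_const_mul, hE, smul_eq_mul]
  have ht' : t ^ (-(α + 1)) = t⁻¹ * t ^ (-α) := by
    rw [neg_add, Real.rpow_add ht, Real.rpow_neg_one, mul_comm]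
  have hPe : (-1 : ℝ) ^ j * Real.Gamma (α + 1) * Polynomial.eval (Real.log t) P =
      ∑ m ∈ Finset.range (j + 1), ((-Real.log t) ^ m * (j.choose m : ℝ)) * M (j - m) := by
    rw [hP, Polynomial.eval_finsetSum, Finset.mul_sum]
    refine Finset.sum_congr rfl fun m _ => ?_
    have hs : (-1 : ℝ) ^ j * (-1) ^ j = 1 := by rw [← mul_pow]; simp
    simp only [Polynomial.eval_mul, Polynomial.eval_C, Polynomial.eval_pow, Polynomial.eval_X]
    rw [neg_pow (Real.log t), pow_add]
    field_simp
    linear_combination ((j.choose m : ℝ) * M (j - m) * Real.log t ^ m) * hs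
  rw [hPe, ht']
  ring
end

section
/- Let α ∈ ℝ with α > −1, let j ∈ ℕ, and let A > 0. Then there exists a monic polynomial P of degree j with real coefficients such that for every ε with 0 < ε < A there is a constant C > 0 with |∫₀^A e^{−t·s} s^α (log s)^j ds − (−1)^j · Γ(α+1) · P(log t) · t^{−(α+1)}| ≤ C e^{−ε t} for all t ≥ 1. -/
open MeasureTheory Set

lemma aux_log_bound (k : ℕ) (δ : ℝ) (hδ : 0 < δ) (s : ℝ) (hs : 0 < s) :
    |Real.log s| ^ k ≤ (k.factorial / δ ^ k) * (s ^ δ + s ^ (-δ)) := by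
  have h1 : (δ * |Real.log s|) ^ k / k.factorial ≤ Real.exp (δ * |Real.log s|) :=
    Real.pow_div_factorial_le_exp _ (by positivity) k
  have h2 : Real.exp (δ * |Real.log s|) ≤ s ^ δ + s ^ (-δ) := by
    rw [Real.rpow_def_of_pos hs, Real.rpow_def_of_pos hs]
    have e1 := Real.exp_pos (Real.log s * δ)
    have e2 := Real.exp_pos (Real.log s * -δ)
    rcases abs_cases (Real.log s) with h | h <;> rw [h.1]
    · rw [mul_comm δ]; linarith
    · rw [show δ * -Real.log s = Real.log s * -δ by ring]; linarith
  have h3 : |Real.log s| ^ k = (k.factorial / δ ^ k) * ((δ * |Real.log s|) ^ k / k.factorial) := by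
    rw [mul_pow]; field_simp
  rw [h3]
  exact mul_le_mul_of_nonneg_left (h1.trans h2) (by positivity)

lemma aux_integrable (α : ℝ) (hα : -1 < α) (k : ℕ) (t : ℝ) (ht : 0 < t) :
    IntegrableOn (fun s : ℝ => Real.exp (-(t * s)) * s ^ α * (Real.log s) ^ k) (Ioi 0) := by
  obtain ⟨δ, hδ, hδ'⟩ : ∃ δ : ℝ, 0 < δ ∧ -1 < α - δ := ⟨(α + 1) / 2, by linarith, by linarith⟩
  have i1 := integrableOn_rpow_mul_exp_neg_mul_rpow (p := 1) (s := α + δ) (b := t)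
    (by linarith) one_pos ht
  have i2 := integrableOn_rpow_mul_exp_neg_mul_rpow (p := 1) (s := α - δ) (b := t)
    hδ' one_pos ht
  refine Integrable.mono' ((Integrable.add i1 i2).const_mul (k.factorial / δ ^ k)) ?_ ?_
  · exact Measurable.aestronglyMeasurable (by fun_prop)
  · refine (ae_restrict_iff' measurableSet_Ioi).2 (Filter.Eventually.of_forall fun s hs => ?_)
    have hs : 0 < s := hs
    have hb := aux_log_bound k δ hδ s hs
    have hp : 0 < Real.exp (-(t * s)) * s ^ α := by positivity
    rw [Real.norm_eq_abs, abs_mul, abs_of_pos hp, abs_pow]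
    refine (mul_le_mul_of_nonneg_left hb hp.le).trans (le_of_eq ?_)
    simp only [Pi.add_apply, Real.rpow_one]
    rw [sub_eq_add_neg, Real.rpow_add hs, Real.rpow_add hs, neg_mul]
    ring

/-- The log-moments of the Gamma density. -/
noncomputable def auxMoment (α : ℝ) (k : ℕ) : ℝ :=
  ∫ s in Ioi (0:ℝ), Real.exp (-(1 * s)) * s ^ α * (Real.log s) ^ k

lemma auxMoment_zero (α : ℝ) (hα : -1 < α) : auxMoment α 0 = Real.Gamma (α + 1) := by
  rw [Real.Gamma_eq_integral (by linarith)]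
  simp [auxMoment]

lemma aux_full (α : ℝ) (hα : -1 < α) (j : ℕ) (t : ℝ) (ht : 0 < t) :
    (∫ s in Ioi (0:ℝ), Real.exp (-(t * s)) * s ^ α * (Real.log s) ^ j) =
      t ^ (-(α + 1)) * ∑ m ∈ Finset.range (j + 1),
        (-Real.log t) ^ m * (j.choose m) * auxMoment α (j - m) := by
  have h := integral_comp_mul_left_Ioi
    (fun u : ℝ => Real.exp (-(1 * u)) * u ^ α * (Real.log u - Real.log t) ^ j) 0 ht
  rw [mul_zero] at h
  have h1 : (∫ s in Ioi (0:ℝ), Real.exp (-(t * s)) * s ^ α * (Real.log s) ^ j) =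
      t ^ (-α) * ∫ s in Ioi (0:ℝ),
        Real.exp (-(1 * (t * s))) * (t * s) ^ α * (Real.log (t * s) - Real.log t) ^ j := by
    rw [← integral_const_mul]
    refine setIntegral_congr_fun measurableSet_Ioi fun s hs => ?_
    have hs : 0 < s := hs
    have : t ^ α ≠ 0 := (Real.rpow_pos_of_pos ht α).ne'
    rw [Real.log_mul ht.ne' hs.ne', Real.mul_rpow ht.le hs.le, Real.rpow_neg ht.le, one_mul,
      add_sub_cancel_left]
    field_simp
  have h2 : (∫ u in Ioi (0:ℝ), Real.exp (-(1 * u)) * u ^ α * (Real.log u - Real.log t) ^ j) =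
      ∑ m ∈ Finset.range (j + 1), (-Real.log t) ^ m * (j.choose m) * auxMoment α (j - m) := by
    unfold auxMoment
    simp_rw [← integral_const_mul]
    rw [← integral_finsetSum]
    · refine setIntegral_congr_fun measurableSet_Ioi fun s hs => ?_
      rw [sub_eq_add_neg, add_comm, add_pow, Finset.mul_sum]
      refine Finset.sum_congr rfl fun m _ => by ring
    · intro m _
      exact (aux_integrable α hα (j - m) 1 one_pos).const_mul _
  rw [h1, h, h2, smul_eq_mul, ← mul_assoc, neg_add, Real.rpow_add ht, Real.rpow_neg_one]

lemma aux_tail (α : ℝ) (hα : -1 < α) (j : ℕ) (A : ℝ) (hA : 0 < A) (t : ℝ) (ht : 1 ≤ t) :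
    |∫ s in Ioi A, Real.exp (-(t * s)) * s ^ α * (Real.log s) ^ j| ≤
      Real.exp (-((t - 1) * A)) *
        ∫ s in Ioi A, ‖Real.exp (-(1 * s)) * s ^ α * (Real.log s) ^ j‖ := by
  rw [← integral_const_mul, ← Real.norm_eq_abs]
  have i1 := (aux_integrable α hα j 1 one_pos).mono_set (Ioi_subset_Ioi hA.le)
  refine norm_integral_le_of_norm_le (i1.norm.const_mul _) ?_
  refine (ae_restrict_iff' measurableSet_Ioi).2 (Filter.Eventually.of_forall fun s hs => ?_)
  have hs : A < s := hs
  rw [mul_assoc, mul_assoc, norm_mul, norm_mul (Real.exp (-(1 * s))), ← mul_assoc,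
    Real.norm_of_nonneg (Real.exp_pos _).le, Real.norm_of_nonneg (Real.exp_pos _).le,
    ← Real.exp_add]
  refine mul_le_mul_of_nonneg_right (Real.exp_le_exp.2 ?_) (norm_nonneg _)
  nlinarith

lemma aux_poly (α : ℝ) (hα : -1 < α) (j : ℕ) :
    ∃ P : Polynomial ℝ, P.Monic ∧ P.natDegree = j ∧ ∀ L : ℝ,
      (-1 : ℝ) ^ j * Real.Gamma (α + 1) * Polynomial.eval L P =
        ∑ m ∈ Finset.range (j + 1), (-L) ^ m * (j.choose m) * auxMoment α (j - m) := by
  have hG : Real.Gamma (α + 1) ≠ 0 := (Real.Gamma_pos_of_pos (by linarith)).ne'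
  set Q : Polynomial ℝ := ∑ m ∈ Finset.range j, Polynomial.C
    ((-1) ^ j * (-1) ^ m * (j.choose m) * auxMoment α (j - m) / Real.Gamma (α + 1)) *
      Polynomial.X ^ m with hQ
  have hd : Q.degree < (j : ℕ) := by
    rw [← Polynomial.mem_degreeLT]
    refine Submodule.sum_mem _ fun m hm => Polynomial.mem_degreeLT.2 ?_
    refine (Polynomial.degree_C_mul_X_pow_le _ _).trans_lt ?_
    exact_mod_cast Finset.mem_range.1 hm
  have hs : ((-1 : ℝ) ^ j) * (-1) ^ j = 1 := by rw [← mul_pow]; simp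
  have hmon : (Polynomial.X ^ j + Q).Monic := Polynomial.monic_X_pow_add hd
  refine ⟨Polynomial.X ^ j + Q, hmon, ?_, fun L => ?_⟩
  · apply Polynomial.natDegree_eq_of_degree_eq_some
    rw [Polynomial.degree_add_eq_left_of_degree_lt (by rwa [Polynomial.degree_X_pow]),
      Polynomial.degree_X_pow]
  · rw [Finset.sum_range_succ, Polynomial.eval_add, mul_add, add_comm, hQ,
      Polynomial.eval_finsetSum, Finset.mul_sum]
    congr 1
    · refine Finset.sum_congr rfl fun m _ => ?_
      simp only [Polynomial.eval_mul, Polynomial.eval_C, Polynomial.eval_pow, Polynomial.eval_X]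
      rw [neg_pow L m]
      field_simp
      linear_combination ((j.choose m : ℝ) * auxMoment α (j - m) * L ^ m) * hs
    · simp only [Polynomial.eval_pow, Polynomial.eval_X]
      rw [Nat.sub_self, auxMoment_zero α hα, neg_pow L j, Nat.choose_self]
      push_cast; ring


/-- for `α > -1`, `j ∈ ℕ` and `A > 0` there is a monic polynomial `P` of degree
`j` such that for every `0 < ε < A` the truncated Laplace integral
`∫₀^A e^{-ts} s^α (log s)^j ds` differs from `(-1)^j Γ(α+1) P(log t) t^{-(α+1)}` by
`O(e^{-εt})` for `t ≥ 1`. -/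
theorem stmt8 (α : ℝ) (hα : -1 < α) (j : ℕ) (A : ℝ) (hA : 0 < A) :
    ∃ P : Polynomial ℝ, P.Monic ∧ P.natDegree = j ∧
      ∀ ε : ℝ, 0 < ε → ε < A → ∃ C : ℝ, 0 < C ∧ ∀ t : ℝ, 1 ≤ t →
        |(∫ s in Set.Ioc (0:ℝ) A, Real.exp (-(t * s)) * s ^ α * (Real.log s) ^ j) -
          (-1 : ℝ) ^ j * Real.Gamma (α + 1) * Polynomial.eval (Real.log t) P *
            t ^ (-(α + 1))| ≤ C * Real.exp (-(ε * t)) := by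
  obtain ⟨P, hP, hd, hev⟩ := aux_poly α hα j
  refine ⟨P, hP, hd, fun ε hε hεA => ?_⟩
  set M := ∫ s in Ioi A, ‖Real.exp (-(1 * s)) * s ^ α * (Real.log s) ^ j‖ with hM
  have hM0 : 0 ≤ M := integral_nonneg fun _ => norm_nonneg _
  refine ⟨Real.exp A * (M + 1), by positivity, fun t ht => ?_⟩
  have ht0 : 0 < t := by linarith
  have hi := aux_integrable α hα j t ht0
  have hsplit := setIntegral_union (μ := volume) (Ioc_disjoint_Ioi_same (a := (0:ℝ)) (b := A))
    measurableSet_Ioi (hi.mono_set Ioc_subset_Ioi_self) (hi.mono_set (Ioi_subset_Ioi hA.le))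
  rw [Ioc_union_Ioi_eq_Ioi hA.le, aux_full α hα j t ht0, ← hev] at hsplit
  have htail := aux_tail α hα j A hA t ht
  rw [← hM] at htail
  have heq : (∫ s in Set.Ioc (0:ℝ) A, Real.exp (-(t * s)) * s ^ α * (Real.log s) ^ j) -
          (-1 : ℝ) ^ j * Real.Gamma (α + 1) * Polynomial.eval (Real.log t) P *
            t ^ (-(α + 1)) =
      -∫ s in Ioi A, Real.exp (-(t * s)) * s ^ α * (Real.log s) ^ j := by
    linear_combination -hsplit
  rw [heq, abs_neg]
  refine htail.trans ?_
  have he : Real.exp (-((t - 1) * A)) ≤ Real.exp A * Real.exp (-(ε * t)) := by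
    rw [← Real.exp_add]
    exact Real.exp_le_exp.2 (by nlinarith)
  calc Real.exp (-((t - 1) * A)) * M ≤ (Real.exp A * Real.exp (-(ε * t))) * (M + 1) :=
        mul_le_mul he (by linarith) hM0 (by positivity)
    _ = _ := by ring
end

section
/- Let A > 0, γ ∈ ℝ, α > −1 and j ∈ ℕ. Let φ : (0, ∞) → ℝ be continuous on (0, A] with φ(s) = 0 for s > A, and assume φ(s) / (s^α (log s)^j) → γ as s → 0⁺. Then ∫₀^A e^{−t·s} φ(s) ds is finite for all t > 0 and t^{α+1} (log t)^{−j} ∫₀^A e^{−t·s} φ(s) ds → (−1)^j · γ · Γ(α+1) as t → +∞. -/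
open MeasureTheory Filter

lemma aux_dom (α : ℝ) (hα : -1 < α) (j : ℕ) :
    IntegrableOn (fun u : ℝ => Real.exp (-u) * u ^ α * (2 + |Real.log u|) ^ j) (Set.Ioi 0) := by
  set ε : ℝ := (α + 1) / (2 * (j + 1)) with hε
  have hj : (0:ℝ) ≤ j := Nat.cast_nonneg j
  have hεpos : 0 < ε := by
    have : 0 < α + 1 := by linarith
    positivity
  have hjε : j * ε < α + 1 := by
    have h1 : ε * (2 * (j + 1)) = α + 1 := by rw [hε]; field_simp
    nlinarith
  have g1 := Real.GammaIntegral_convergent (s := α + j * ε + 1) (by nlinarith)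
  have g2 := Real.GammaIntegral_convergent (s := α - j * ε + 1) (by linarith)
  set K : ℝ := 2 + 1 / ε with hK
  have hKpos : 0 < K := by positivity
  have g := (g1.add g2).const_mul (K ^ j * 2 ^ (j - 1))
  refine Integrable.mono' g (by fun_prop) ?_
  filter_upwards [ae_restrict_mem measurableSet_Ioi] with u hu
  have hu : 0 < u := hu
  have e1 : u ^ (α + j * ε + 1 - 1) = u ^ α * (u ^ ε) ^ j := by
    rw [← Real.rpow_natCast, ← Real.rpow_mul hu.le, ← Real.rpow_add hu]; congr 1; ring
  have e2 : u ^ (α - j * ε + 1 - 1) = u ^ α * (u ^ (-ε)) ^ j := by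
    rw [← Real.rpow_natCast, ← Real.rpow_mul hu.le, ← Real.rpow_add hu]; congr 1; ring
  have p1 : 0 < u ^ ε := Real.rpow_pos_of_pos hu _
  have p2 : 0 < u ^ (-ε) := Real.rpow_pos_of_pos hu _
  have p3 : 0 < u ^ α := Real.rpow_pos_of_pos hu _
  have hsum : 1 ≤ u ^ ε + u ^ (-ε) := by
    rcases le_total 1 u with h | h
    · linarith [Real.one_le_rpow h hεpos.le]
    · linarith [Real.one_le_rpow_of_pos_of_le_one_of_nonpos hu h (by linarith : -ε ≤ 0)]
  have l1 : Real.log u ≤ u ^ ε / ε := Real.log_le_rpow_div hu.le hεpos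
  have l2 : -Real.log u ≤ u ^ (-ε) / ε := by
    have := Real.log_le_rpow_div (inv_pos.2 hu).le hεpos
    rwa [Real.log_inv, Real.inv_rpow hu.le, ← Real.rpow_neg hu.le] at this
  have l3 : |Real.log u| ≤ (u ^ ε + u ^ (-ε)) / ε := by
    have q1 : 0 < u ^ ε / ε := by positivity
    have q2 : 0 < u ^ (-ε) / ε := by positivity
    rw [add_div]
    exact abs_le.2 ⟨by linarith, by linarith⟩
  have l4 : 2 + |Real.log u| ≤ K * (u ^ ε + u ^ (-ε)) := by
    have : K * (u ^ ε + u ^ (-ε)) = 2 * (u ^ ε + u ^ (-ε)) + (u ^ ε + u ^ (-ε)) / ε := by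
      rw [hK]; ring
    linarith
  have l5 : (2 + |Real.log u|) ^ j ≤ K ^ j * (2 ^ (j - 1) * ((u ^ ε) ^ j + (u ^ (-ε)) ^ j)) := by
    calc _ ≤ (K * (u ^ ε + u ^ (-ε))) ^ j := pow_le_pow_left₀ (by positivity) l4 j
      _ = K ^ j * (u ^ ε + u ^ (-ε)) ^ j := mul_pow _ _ _
      _ ≤ _ := by
        gcongr
        exact add_pow_le p1.le p2.le j
  rw [Real.norm_of_nonneg (by positivity)]
  simp only [Pi.add_apply]
  rw [e1, e2]
  calc _ ≤ Real.exp (-u) * u ^ α * (K ^ j * (2 ^ (j - 1) * ((u ^ ε) ^ j + (u ^ (-ε)) ^ j))) := by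
        gcongr
    _ = _ := by ring

lemma aux_bound (A : ℝ) (hA : 0 < A) (γ α : ℝ) (j : ℕ)
    (φ : ℝ → ℝ) (hcont : ContinuousOn φ (Set.Ioc 0 A))
    (hzero : ∀ s : ℝ, A < s → φ s = 0)
    (hasymp : Tendsto (fun s => φ s / (s ^ α * (Real.log s) ^ j))
      (nhdsWithin 0 (Set.Ioi 0)) (nhds γ)) :
    ∃ M : ℝ, 0 ≤ M ∧ ∀ s, 0 < s → |φ s| ≤ M * (s ^ α * (1 + |Real.log s|) ^ j) := by
  have h1 : ∀ᶠ s in nhdsWithin (0:ℝ) (Set.Ioi 0), |φ s / (s ^ α * (Real.log s) ^ j)| < |γ| + 1 :=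
    hasymp.abs.eventually (gt_mem_nhds (by linarith))
  rw [eventually_nhdsWithin_iff, Metric.eventually_nhds_iff] at h1
  obtain ⟨δ, hδ, h1⟩ := h1
  set d : ℝ := min (δ / 2) (1 / 2) with hd
  have hdpos : 0 < d := by positivity
  have hdδ : d < δ := lt_of_le_of_lt (min_le_left _ _) (by linarith)
  have hd1 : d < 1 := lt_of_le_of_lt (min_le_right _ _) (by norm_num)
  have hc : ContinuousOn (fun s => φ s / (s ^ α * (1 + |Real.log s|) ^ j)) (Set.Icc d A) := by
    have hpos : ∀ s ∈ Set.Icc d A, s ≠ 0 := fun s hs => (hdpos.trans_le hs.1).ne'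
    refine ContinuousOn.div (hcont.mono fun s hs => ⟨hdpos.trans_le hs.1, hs.2⟩) ?_ ?_
    · refine ContinuousOn.mul (fun s hs => (Real.continuousAt_rpow_const s α (Or.inl (hpos s hs))).continuousWithinAt) ?_
      exact (continuousOn_const.add (continuousOn_id.log hpos).abs).pow j
    · intro s hs
      have : 0 < s ^ α := Real.rpow_pos_of_pos (hdpos.trans_le hs.1) _
      positivity
  obtain ⟨C, hC⟩ := isCompact_Icc.exists_bound_of_continuousOn hc
  refine ⟨max (|γ| + 1) C, le_max_of_le_left (by positivity), fun s hs => ?_⟩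
  have p : 0 < s ^ α := Real.rpow_pos_of_pos hs _
  have P : 0 < s ^ α * (1 + |Real.log s|) ^ j := by positivity
  rcases lt_or_ge s d with h | h
  · have h2 := h1 (y := s) (by rw [Real.dist_eq, sub_zero, abs_of_pos hs]; linarith) hs
    have hl : Real.log s < 0 := Real.log_neg hs (by linarith)
    have hl' : 0 < |Real.log s| := abs_pos.2 hl.ne
    rw [abs_div, abs_mul, abs_pow, abs_of_pos p, div_lt_iff₀ (by positivity)] at h2
    calc |φ s| ≤ (|γ| + 1) * (s ^ α * |Real.log s| ^ j) := h2.le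
      _ ≤ _ := by
        gcongr
        · exact le_max_left _ _
        · linarith
  · rcases le_or_gt s A with h' | h'
    · have h2 := hC s ⟨h, h'⟩
      rw [Real.norm_eq_abs, abs_div, abs_of_pos P, div_le_iff₀ P] at h2
      refine h2.trans ?_
      gcongr
      exact le_max_right _ _
    · rw [hzero s h', abs_zero]
      have : 0 ≤ max (|γ| + 1) C := le_max_of_le_left (by positivity)
      positivity

lemma aux_main (γ α : ℝ) (hα : -1 < α) (j : ℕ) (φ : ℝ → ℝ) (hm : Measurable φ) (M : ℝ)
    (hM0 : 0 ≤ M) (hM : ∀ s, 0 < s → |φ s| ≤ M * (s ^ α * (1 + |Real.log s|) ^ j))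
    (hasymp : Tendsto (fun s => φ s / (s ^ α * (Real.log s) ^ j))
      (nhdsWithin 0 (Set.Ioi 0)) (nhds γ)) :
    Tendsto (fun t : ℝ => t ^ (α + 1) * ((Real.log t) ^ j)⁻¹ *
        ∫ s in Set.Ioi (0:ℝ), Real.exp (-(t * s)) * φ s)
      atTop (nhds ((-1 : ℝ) ^ j * γ * Real.Gamma (α + 1))) := by
  have key : Tendsto (fun t : ℝ => ∫ u in Set.Ioi (0:ℝ),
      t ^ α * ((Real.log t) ^ j)⁻¹ * (Real.exp (-u) * φ (u / t))) atTop
      (nhds (∫ u in Set.Ioi (0:ℝ), (-1 : ℝ) ^ j * γ * (Real.exp (-u) * u ^ (α + 1 - 1)))) := by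
    refine tendsto_integral_filter_of_dominated_convergence
      (fun u => M * (Real.exp (-u) * u ^ α * (2 + |Real.log u|) ^ j)) ?_ ?_ ?_ ?_
    · refine Eventually.of_forall fun t => Measurable.aestronglyMeasurable ?_
      fun_prop
    · filter_upwards [eventually_ge_atTop (Real.exp 1)] with t ht
      have htp : 0 < t := (Real.exp_pos 1).trans_le ht
      have hL : 1 ≤ Real.log t := by rwa [Real.le_log_iff_exp_le htp]
      filter_upwards [ae_restrict_mem measurableSet_Ioi] with u hu
      have hu : 0 < u := hu
      have p1 : 0 < t ^ α := Real.rpow_pos_of_pos htp _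
      have p2 : 0 < u ^ α := Real.rpow_pos_of_pos hu _
      have hLp : 0 < Real.log t := by linarith
      have b := hM (u / t) (by positivity)
      rw [Real.div_rpow hu.le htp.le, Real.log_div hu.ne' htp.ne'] at b
      have b2 : 1 + |Real.log u - Real.log t| ≤ (2 + |Real.log u|) * Real.log t := by
        have := abs_sub (Real.log u) (Real.log t)
        rw [abs_of_pos hLp] at this
        nlinarith [abs_nonneg (Real.log u)]
      rw [Real.norm_eq_abs, abs_mul, abs_mul, abs_mul, abs_of_pos p1, abs_of_pos (Real.exp_pos _),
        abs_of_pos (by positivity : 0 < ((Real.log t) ^ j)⁻¹)]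
      calc _ ≤ t ^ α * ((Real.log t) ^ j)⁻¹ * (Real.exp (-u) *
            (M * (u ^ α / t ^ α * ((2 + |Real.log u|) * Real.log t) ^ j))) := by
            gcongr
            refine b.trans ?_
            gcongr
        _ = _ := by rw [mul_pow]; field_simp
    · exact (aux_dom α hα j).const_mul M
    · filter_upwards [ae_restrict_mem measurableSet_Ioi] with u hu
      have hu : 0 < u := hu
      have p2 : 0 < u ^ α := Real.rpow_pos_of_pos hu _
      have t0 : Tendsto (fun t : ℝ => u / t) atTop (nhdsWithin 0 (Set.Ioi 0)) := by
        refine tendsto_nhdsWithin_iff.2 ⟨tendsto_const_nhds.div_atTop tendsto_id, ?_⟩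
        filter_upwards [eventually_gt_atTop 0] with t ht
        exact div_pos hu ht
      have t1 := hasymp.comp t0
      have t2 : Tendsto (fun t : ℝ => Real.log u / Real.log t - 1) atTop (nhds (0 - 1)) :=
        (tendsto_const_nhds.div_atTop Real.tendsto_log_atTop).sub_const 1
      have t3 := ((t1.mul (t2.pow j)).mul_const (Real.exp (-u) * u ^ α))
      have : γ * (0 - 1) ^ j * (Real.exp (-u) * u ^ α) =
        (-1 : ℝ) ^ j * γ * (Real.exp (-u) * u ^ (α + 1 - 1)) := by
        rw [zero_sub, add_sub_cancel_right]; ring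
      rw [this] at t3
      refine t3.congr' ?_
      filter_upwards [eventually_gt_atTop 1, eventually_gt_atTop u] with t ht htu
      have htp : 0 < t := by linarith
      have p1 : 0 < t ^ α := Real.rpow_pos_of_pos htp _
      have hLp : 0 < Real.log t := Real.log_pos ht
      have hne : Real.log u - Real.log t ≠ 0 := (sub_neg.2 (Real.log_lt_log hu htu)).ne
      simp only [Function.comp]
      rw [Real.div_rpow hu.le htp.le, Real.log_div hu.ne' htp.ne', div_sub_one hLp.ne', div_pow]
      field_simp
  rw [integral_const_mul, ← Real.Gamma_eq_integral (by linarith)] at key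
  refine key.congr' ?_
  filter_upwards [eventually_gt_atTop 0] with t ht
  have h := integral_comp_mul_left_Ioi (fun u => Real.exp (-u) * φ (u / t)) 0 ht
  rw [mul_zero] at h
  have h' : ∀ s, t * s / t = s := fun s => by field_simp
  simp only [h', smul_eq_mul] at h
  rw [integral_const_mul, h, Real.rpow_add ht, Real.rpow_one]
  field_simp


/-- if `φ` is continuous on `(0, A]`, vanishes beyond `A`, and satisfies
`φ(s) / (s^α (log s)^j) → γ` as `s → 0⁺`, then the Laplace integrals `∫₀^A e^{-ts} φ(s) ds`
are finite and `t^{α+1} (log t)^{-j} ∫₀^A e^{-ts} φ(s) ds → (-1)^j γ Γ(α+1)` as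
`t → +∞`. -/
theorem stmt10 (A : ℝ) (hA : 0 < A) (γ α : ℝ) (hα : -1 < α) (j : ℕ)
    (φ : ℝ → ℝ) (hcont : ContinuousOn φ (Set.Ioc 0 A))
    (hzero : ∀ s : ℝ, A < s → φ s = 0)
    (hasymp : Tendsto (fun s => φ s / (s ^ α * (Real.log s) ^ j))
      (nhdsWithin 0 (Set.Ioi 0)) (nhds γ)) :
    (∀ t : ℝ, 0 < t →
      IntegrableOn (fun s => Real.exp (-(t * s)) * φ s) (Set.Ioc 0 A)) ∧
    Tendsto (fun t : ℝ => t ^ (α + 1) * ((Real.log t) ^ j)⁻¹ *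
        ∫ s in Set.Ioc (0:ℝ) A, Real.exp (-(t * s)) * φ s)
      atTop (nhds ((-1 : ℝ) ^ j * γ * Real.Gamma (α + 1))) := by


  obtain ⟨M, hM0, hM⟩ := aux_bound A hA γ α j φ hcont hzero hasymp
  constructor
  · intro t ht
    have g := ((aux_dom α hα j).mono_set (fun s (hs : s ∈ Set.Ioc 0 A) => hs.1)).const_mul
      (M * Real.exp A)
    refine Integrable.mono' g ?_ ?_
    · refine ContinuousOn.aestronglyMeasurable ?_ measurableSet_Ioc
      exact ContinuousOn.mul (by fun_prop) hcont
    · filter_upwards [ae_restrict_mem measurableSet_Ioc] with s hs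
      have hs0 : 0 < s := hs.1
      have p2 : 0 < s ^ α := Real.rpow_pos_of_pos hs0 _
      have e1 : Real.exp (-(t * s)) ≤ Real.exp A * Real.exp (-s) := by
        rw [← Real.exp_add]
        apply Real.exp_le_exp.2
        have := hs.2
        nlinarith [mul_pos ht hs0]
      rw [Real.norm_eq_abs, abs_mul, abs_of_pos (Real.exp_pos _)]
      calc _ ≤ (Real.exp A * Real.exp (-s)) * (M * (s ^ α * (2 + |Real.log s|) ^ j)) := by
            gcongr
            refine (hM s hs0).trans ?_
            gcongr
            norm_num
        _ = _ := by ring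
  · have hm : Measurable ((Set.Ioc 0 A).indicator φ) := by
      have := ContinuousOn.measurable_piecewise (s := Set.Ioc 0 A) (f := φ) (g := fun _ => 0)
        hcont continuousOn_const measurableSet_Ioc
      classical
      convert this using 1
      rw [← Set.piecewise_eq_indicator]
      congr
    have heq : ∀ s, 0 < s → (Set.Ioc 0 A).indicator φ s = φ s := by
      intro s hs
      by_cases h : s ≤ A
      · exact Set.indicator_of_mem (show s ∈ Set.Ioc 0 A from ⟨hs, h⟩) φ
      · rw [hzero s (not_le.1 h)]
        exact Set.indicator_of_notMem (fun h' => h h'.2) _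
    have main := aux_main γ α hα j ((Set.Ioc 0 A).indicator φ) hm M hM0
      (fun s hs => by rw [heq s hs]; exact hM s hs)
      (hasymp.congr' (by
        filter_upwards [self_mem_nhdsWithin] with s hs
        rw [heq s hs]))
    refine main.congr fun t => ?_
    congr 1
    have : (fun s => Real.exp (-(t * s)) * (Set.Ioc 0 A).indicator φ s) =
        (Set.Ioc 0 A).indicator (fun s => Real.exp (-(t * s)) * φ s) := by
      ext s
      by_cases h : s ∈ Set.Ioc 0 A <;> simp [h]
    rw [this, setIntegral_indicator measurableSet_Ioc,
      Set.inter_eq_self_of_subset_right Set.Ioc_subset_Ioi_self]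
end

section
/- Let A > 0, γ ∈ ℝ, α > −1, j ∈ ℕ, K > α and C₀ ≥ 0. Let φ : (0, A] → ℝ be measurable with |φ(s) − γ · s^α (log s)^j| ≤ C₀ · s^K for all s ∈ (0, A]. Then there exist a real polynomial P of degree at most j whose coefficient of x^j equals (−1)^j γ Γ(α+1), a constant C > 0, and T ≥ 1 such that for all t ≥ T, |∫₀^A e^{−t·s} φ(s) ds − P(log t) · t^{−(α+1)}| ≤ C · t^{−(K+1)}. -/
open MeasureTheory

lemma aux_int (α : ℝ) (hα : -1 < α) (m : ℕ) :
    IntegrableOn (fun u : ℝ => Real.exp (-u) * (u ^ α * (Real.log u) ^ m)) (Set.Ioi 0) := by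
  obtain ⟨ε, hε, hεm⟩ : ∃ ε : ℝ, 0 < ε ∧ ε * m < α + 1 := by
    refine ⟨(α + 1) / (m + 1), by apply div_pos <;> [linarith; positivity], ?_⟩
    have hm : (0:ℝ) < m + 1 := by positivity
    rw [div_mul_eq_mul_div, div_lt_iff₀ hm]
    nlinarith
  have hm0 : 0 ≤ ε * m := by positivity
  have h1 := Real.GammaIntegral_convergent (s := α + 1 + ε * m) (by linarith)
  have h2 := Real.GammaIntegral_convergent (s := α + 1 - ε * m) (by linarith)
  have h3 := ((h1.add h2).const_mul ((ε⁻¹) ^ m))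
  refine Integrable.mono' h3 ?_ ?_
  · apply Measurable.aestronglyMeasurable
    fun_prop
  · refine (ae_restrict_iff' measurableSet_Ioi).2 (Filter.Eventually.of_forall fun u hu => ?_)
    have hu : 0 < u := hu
    have key : |Real.log u| ^ m ≤ (ε⁻¹) ^ m * (u ^ (ε * m) + u ^ (-(ε * m))) := by
      have hp := Real.rpow_pos_of_pos hu (ε * m)
      have hn := Real.rpow_pos_of_pos hu (-(ε * m))
      have hi : 0 < (ε⁻¹) ^ m := by positivity
      rcases le_total 1 u with h | h
      · have hl : |Real.log u| ≤ ε⁻¹ * u ^ ε := by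
          rw [abs_of_nonneg (Real.log_nonneg h)]
          have := Real.log_le_rpow_div hu.le hε
          rwa [div_eq_inv_mul] at this
        have := pow_le_pow_left₀ (abs_nonneg _) hl m
        rw [mul_pow, ← Real.rpow_mul_natCast hu.le] at this
        nlinarith
      · have hl : |Real.log u| ≤ ε⁻¹ * u ^ (-ε) := by
          rw [abs_of_nonpos (Real.log_nonpos hu.le h), ← Real.log_inv]
          have := Real.log_le_rpow_div (inv_pos.2 hu).le hε
          rwa [div_eq_inv_mul, Real.inv_rpow hu.le, ← Real.rpow_neg hu.le] at this
        have := pow_le_pow_left₀ (abs_nonneg _) hl m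
        rw [mul_pow, ← Real.rpow_mul_natCast hu.le, neg_mul] at this
        nlinarith
    simp only [Pi.add_apply, Real.norm_eq_abs, abs_mul, Real.abs_exp, abs_pow]
    rw [abs_of_pos (Real.rpow_pos_of_pos hu α)]
    have e1 : u ^ (α + 1 + ε * m - 1) = u ^ α * u ^ (ε * m) := by
      rw [← Real.rpow_add hu]; congr 1; ring
    have e2 : u ^ (α + 1 - ε * m - 1) = u ^ α * u ^ (-(ε * m)) := by
      rw [← Real.rpow_add hu]; congr 1; ring
    rw [e1, e2]
    calc _ ≤ Real.exp (-u) * (u ^ α * ((ε⁻¹) ^ m * (u ^ (ε * m) + u ^ (-(ε * m))))) := by gcongr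
      _ = _ := by ring

lemma aux_int_t (α : ℝ) (hα : -1 < α) (m : ℕ) (t : ℝ) (ht : 1 ≤ t) :
    IntegrableOn (fun u : ℝ => Real.exp (-(t * u)) * (u ^ α * (Real.log u) ^ m)) (Set.Ioi 0) := by
  refine Integrable.mono (aux_int α hα m) ?_ ?_
  · apply Measurable.aestronglyMeasurable
    fun_prop
  · refine (ae_restrict_iff' measurableSet_Ioi).2 (Filter.Eventually.of_forall fun u hu => ?_)
    have hu : 0 < u := hu
    rw [norm_mul, norm_mul (Real.exp (-u))]
    gcongr
    simp only [Real.norm_eq_abs, Real.abs_exp]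
    apply Real.exp_le_exp.2
    nlinarith

lemma aux_eval (α : ℝ) (hα : -1 < α) (j : ℕ) (t : ℝ) (ht : 0 < t) :
    ∫ s in Set.Ioi (0:ℝ), Real.exp (-(t * s)) * (s ^ α * (Real.log s) ^ j) =
      (∑ m ∈ Finset.range (j + 1), (∫ u in Set.Ioi (0:ℝ), Real.exp (-u) * (u ^ α * (Real.log u) ^ m))
        * (-Real.log t) ^ (j - m) * (j.choose m)) * t ^ (-(α + 1)) := by
  have h := integral_comp_mul_left_Ioi
    (fun u : ℝ => Real.exp (-u) * (u ^ α * (Real.log u - Real.log t) ^ j)) 0 ht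
  have e1 : ∫ s in Set.Ioi (0:ℝ), Real.exp (-(t * s)) * ((t * s) ^ α *
      (Real.log (t * s) - Real.log t) ^ j) =
      t ^ α * ∫ s in Set.Ioi (0:ℝ), Real.exp (-(t * s)) * (s ^ α * (Real.log s) ^ j) := by
    rw [← integral_const_mul]
    refine setIntegral_congr_fun measurableSet_Ioi fun s hs => ?_
    have hs : 0 < s := hs
    rw [Real.mul_rpow ht.le hs.le, Real.log_mul ht.ne' hs.ne']
    ring
  have e2 : ∫ u in Set.Ioi (0:ℝ), Real.exp (-u) * (u ^ α * (Real.log u - Real.log t) ^ j) =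
      ∑ m ∈ Finset.range (j + 1), (∫ u in Set.Ioi (0:ℝ), Real.exp (-u) * (u ^ α * (Real.log u) ^ m))
        * (-Real.log t) ^ (j - m) * (j.choose m) := by
    simp_rw [mul_assoc _ (_ ^ (_ - _))]
    simp_rw [← integral_mul_const]
    rw [← integral_finsetSum]
    · congr 1
      ext u
      rw [sub_eq_add_neg, add_pow, Finset.mul_sum, Finset.mul_sum]
      refine Finset.sum_congr rfl fun m _ => ?_
      ring
    · intro m _
      exact (aux_int α hα m).mul_const _
  rw [e1, mul_zero, e2, smul_eq_mul] at h
  have hp := Real.rpow_pos_of_pos ht α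
  rw [Real.rpow_neg ht.le, Real.rpow_add ht, Real.rpow_one]
  field_simp
  field_simp at h
  linarith

/-- finite-order quantitative Laplace asymptotics. If
`|φ(s) - γ s^α (log s)^j| ≤ C₀ s^K` on `(0, A]` with `K > α > -1`, then there is a real
polynomial `P` of degree at most `j` with leading coefficient `(-1)^j γ Γ(α+1)` in degree
`j` such that `∫₀^A e^{-ts} φ(s) ds = P(log t) t^{-(α+1)} + O(t^{-(K+1)})` as `t → ∞`. -/
theorem stmt11 (A : ℝ) (hA : 0 < A) (γ α K : ℝ) (hα : -1 < α) (hK : α < K)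
    (j : ℕ) (C₀ : ℝ) (hC₀ : 0 ≤ C₀)
    (φ : ℝ → ℝ)
    (hmeas : AEStronglyMeasurable φ (volume.restrict (Set.Ioc 0 A)))
    (hbound : ∀ s ∈ Set.Ioc (0:ℝ) A,
      |φ s - γ * s ^ α * (Real.log s) ^ j| ≤ C₀ * s ^ K) :
    ∃ P : Polynomial ℝ, P.degree ≤ (j : ℕ) ∧
      P.coeff j = (-1 : ℝ) ^ j * γ * Real.Gamma (α + 1) ∧
      ∃ C : ℝ, 0 < C ∧ ∃ T : ℝ, 1 ≤ T ∧ ∀ t : ℝ, T ≤ t →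
        |(∫ s in Set.Ioc (0:ℝ) A, Real.exp (-(t * s)) * φ s) -
          Polynomial.eval (Real.log t) P * t ^ (-(α + 1))| ≤ C * t ^ (-(K + 1)) := by
  set M : ℕ → ℝ := fun m => ∫ u in Set.Ioi (0:ℝ), Real.exp (-u) * (u ^ α * (Real.log u) ^ m)
    with hM
  set B : ℝ := ∫ u in Set.Ioi A, |Real.exp (-u) * (u ^ α * (Real.log u) ^ j)| with hB
  have hB0 : 0 ≤ B := integral_nonneg fun u => abs_nonneg _
  have hG : 0 < Real.Gamma (K + 1) := Real.Gamma_pos_of_pos (by linarith)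
  have hsub : Set.Ioi A ⊆ Set.Ioi (0:ℝ) := Set.Ioi_subset_Ioi hA.le
  obtain ⟨T₀, hT₀⟩ : ∃ T₀ : ℝ, ∀ t ≥ T₀, t ^ (K + 1) * Real.exp (-A * t) ≤ 1 := by
    have := (tendsto_rpow_mul_exp_neg_mul_atTop_nhds_zero (K + 1) A hA).eventually_le_const
      (show (0:ℝ) < 1 by norm_num)
    exact Filter.eventually_atTop.1 this
  refine ⟨∑ m ∈ Finset.range (j + 1),
    Polynomial.monomial (j - m) (γ * (M m * (-1) ^ (j - m) * (j.choose m))), ?_, ?_,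
    C₀ * Real.Gamma (K + 1) + |γ| * (Real.exp A * B) + 1, by positivity, max 1 T₀,
    le_max_left _ _, ?_⟩
  · refine (Polynomial.degree_sum_le _ _).trans (Finset.sup_le fun m _ => ?_)
    refine (Polynomial.degree_monomial_le _ _).trans ?_
    exact_mod_cast Nat.sub_le j m
  · rw [Polynomial.finsetSum_coeff, Finset.sum_eq_single 0]
    · have : M 0 = Real.Gamma (α + 1) := by
        rw [Real.Gamma_eq_integral (by linarith)]
        simp [hM]
      simp [this]
      ring
    · intro m hm hm0
      rw [Polynomial.coeff_monomial, if_neg]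
      have := Finset.mem_range.1 hm
      omega
    · simp
  intro t ht
  have ht1 : 1 ≤ t := (le_max_left _ _).trans ht
  have htT : T₀ ≤ t := (le_max_right _ _).trans ht
  have ht0 : 0 < t := by linarith
  have hev : Polynomial.eval (Real.log t) (∑ m ∈ Finset.range (j + 1),
      Polynomial.monomial (j - m) (γ * (M m * (-1) ^ (j - m) * (j.choose m)))) * t ^ (-(α + 1))
      = γ * ∫ s in Set.Ioi (0:ℝ), Real.exp (-(t * s)) * (s ^ α * (Real.log s) ^ j) := by
    rw [aux_eval α hα j t ht0, Polynomial.eval_finsetSum, ← mul_assoc, Finset.mul_sum]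
    congr 1
    refine Finset.sum_congr rfl fun m _ => ?_
    rw [Polynomial.eval_monomial, neg_pow (Real.log t)]
    ring
  rw [hev]
  have hI := aux_int_t α hα j t ht1
  have hIK := aux_int_t K (by linarith) 0 t ht1
  simp only [pow_zero, mul_one] at hIK
  have hsplit : ∫ s in Set.Ioi (0:ℝ), Real.exp (-(t * s)) * (s ^ α * (Real.log s) ^ j) =
      (∫ s in Set.Ioc (0:ℝ) A, Real.exp (-(t * s)) * (s ^ α * (Real.log s) ^ j)) +
      ∫ s in Set.Ioi A, Real.exp (-(t * s)) * (s ^ α * (Real.log s) ^ j) := by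
    rw [← Set.Ioc_union_Ioi_eq_Ioi hA.le]
    exact setIntegral_union (Set.Ioc_disjoint_Ioi le_rfl) measurableSet_Ioi
      (hI.mono_set Set.Ioc_subset_Ioi_self) (hI.mono_set hsub)
  have hIc := hI.mono_set (Set.Ioc_subset_Ioi_self : Set.Ioc 0 A ⊆ Set.Ioi 0)
  have hIKc := (hIK.mono_set (Set.Ioc_subset_Ioi_self : Set.Ioc 0 A ⊆ Set.Ioi 0)).const_mul C₀
  have hle : ∀ᵐ s ∂(volume.restrict (Set.Ioc 0 A)),
      ‖Real.exp (-(t * s)) * (φ s - γ * s ^ α * (Real.log s) ^ j)‖ ≤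
        C₀ * (Real.exp (-(t * s)) * s ^ K) := by
    refine (ae_restrict_iff' measurableSet_Ioc).2 (Filter.Eventually.of_forall fun u hu => ?_)
    rw [norm_mul, Real.norm_eq_abs, Real.norm_eq_abs, Real.abs_exp]
    calc _ ≤ Real.exp (-(t * u)) * (C₀ * u ^ K) := by gcongr; exact hbound u hu
      _ = _ := by ring
  have hR : IntegrableOn (fun s => Real.exp (-(t * s)) * (φ s - γ * s ^ α * (Real.log s) ^ j))
      (Set.Ioc 0 A) := by
    refine Integrable.mono' hIKc ?_ hle
    refine AEStronglyMeasurable.mul ?_ (hmeas.sub ?_)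
    · apply Measurable.aestronglyMeasurable
      fun_prop
    · apply Measurable.aestronglyMeasurable
      fun_prop
  have hRb : |∫ s in Set.Ioc (0:ℝ) A,
      Real.exp (-(t * s)) * (φ s - γ * s ^ α * (Real.log s) ^ j)| ≤
      C₀ * Real.Gamma (K + 1) * t ^ (-(K + 1)) := by
    refine (norm_integral_le_of_norm_le hIKc hle).trans ?_
    rw [integral_const_mul, mul_assoc]
    gcongr
    have hg := Real.integral_rpow_mul_exp_neg_mul_Ioi (a := K + 1) (r := t) (by linarith) ht0
    rw [one_div, Real.inv_rpow ht0.le, ← Real.rpow_neg ht0.le, add_sub_cancel_right] at hg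
    rw [mul_comm, ← hg]
    simp_rw [mul_comm (_ ^ K)]
    refine setIntegral_mono_set hIK ?_ Set.Ioc_subset_Ioi_self.eventuallyLE
    refine (ae_restrict_iff' measurableSet_Ioi).2 (Filter.Eventually.of_forall fun u hu => ?_)
    have := Real.rpow_pos_of_pos hu K
    simp only [Pi.zero_apply]
    positivity
  have hexp : Real.exp (-((t - 1) * A)) ≤ Real.exp A * t ^ (-(K + 1)) := by
    have h1 := hT₀ t htT
    have h2 := Real.rpow_pos_of_pos ht0 (K + 1)
    rw [show -((t - 1) * A) = A + -A * t by ring, Real.exp_add, Real.rpow_neg ht0.le]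
    gcongr
    rw [le_inv_comm₀ (Real.exp_pos _) h2, ← one_div, le_div_iff₀ (Real.exp_pos _)]
    exact h1
  have hTb : |∫ s in Set.Ioi A, Real.exp (-(t * s)) * (s ^ α * (Real.log s) ^ j)| ≤
      Real.exp A * B * t ^ (-(K + 1)) := by
    have hJ : IntegrableOn (fun u => Real.exp (-((t - 1) * A)) *
        |Real.exp (-u) * (u ^ α * (Real.log u) ^ j)|) (Set.Ioi A) :=
      (((aux_int α hα j).mono_set hsub).abs).const_mul _
    have := norm_integral_le_of_norm_le
      (f := fun s => Real.exp (-(t * s)) * (s ^ α * (Real.log s) ^ j)) hJ ?_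
    · rw [integral_const_mul, ← hB] at this
      refine this.trans ?_
      calc _ ≤ (Real.exp A * t ^ (-(K + 1))) * B := by gcongr
        _ = _ := by ring
    · refine (ae_restrict_iff' measurableSet_Ioi).2 (Filter.Eventually.of_forall fun u hu => ?_)
      have hu : A < u := hu
      rw [norm_mul, abs_mul, ← mul_assoc, Real.norm_eq_abs, Real.norm_eq_abs, Real.abs_exp,
        Real.abs_exp, ← Real.exp_add]
      gcongr
      nlinarith
  have hmain : (∫ s in Set.Ioc (0:ℝ) A, Real.exp (-(t * s)) * φ s) =
      (∫ s in Set.Ioc (0:ℝ) A, Real.exp (-(t * s)) * (φ s - γ * s ^ α * (Real.log s) ^ j)) +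
      γ * ∫ s in Set.Ioc (0:ℝ) A, Real.exp (-(t * s)) * (s ^ α * (Real.log s) ^ j) := by
    rw [← integral_const_mul, ← integral_add hR (hIc.const_mul γ)]
    congr 1
    ext s
    ring
  rw [hmain, hsplit]
  have hpos := Real.rpow_pos_of_pos ht0 (-(K + 1))
  rw [show ∀ a b c : ℝ, a + γ * b - γ * (b + c) = a - γ * c by intros; ring]
  refine (abs_sub _ _).trans ?_
  rw [abs_mul]
  have := mul_le_mul_of_nonneg_left hTb (abs_nonneg γ)
  nlinarith
end

section
/- Let d ≥ 1 and let f : ℝ^d → ℝ be three times continuously differentiable with f(0) = 0, with vanishing derivative at 0, and with positive definite Hessian at 0 (i.e. the second derivative satisfies D²f(0)(v,v) > 0 for every v ≠ 0). Let ρ : ℝ^d → ℝ be continuous with compact support, 0 ≤ ρ ≤ 1, ρ ≡ 1 on a neighborhood of 0, and suppose f(x) > 0 for every x ≠ 0 in the support of ρ. Then there exists a constant c > 0 such that t^{d/2} · ∫_{ℝ^d} e^{−t f(x)} ρ(x) dx → c as t → +∞. -/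
open MeasureTheory Filter

lemma taylor_two {E : Type*} [NormedAddCommGroup E] [NormedSpace ℝ E] (f : E → ℝ)
    (hf : ContDiff ℝ 3 f) (hf0 : f 0 = 0) (hdf : fderiv ℝ f 0 = 0) {ε : ℝ} (hε : 0 < ε) :
    ∀ᶠ x in nhds (0 : E), |f x - 1 / 2 * fderiv ℝ (fderiv ℝ f) 0 x x| ≤ ε * ‖x‖ ^ 2 := by
  set A := fderiv ℝ (fderiv ℝ f) 0 with hA
  have hd1 : ContDiff ℝ 2 (fderiv ℝ f) := hf.fderiv_right (by norm_num)
  have hAd : HasFDerivAt (fderiv ℝ f) A 0 :=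
    (hd1.differentiable (by norm_num) 0).hasFDerivAt
  have hsymm : ∀ v w, A v w = A w v := by
    have := (hf.contDiffAt (x := (0 : E))).isSymmSndFDerivAt (by simp; norm_num)
    exact fun v w => this v w
  have ho := hAd.isLittleO.def hε
  simp only [hdf, sub_zero] at ho
  obtain ⟨r, hr, hball⟩ := Metric.eventually_nhds_iff_ball.1 ho
  have hder : ∀ x, HasFDerivAt (fun x => f x - 1 / 2 * A x x) (fderiv ℝ f x - A x) x := by
    intro x
    have h1 : HasFDerivAt f (fderiv ℝ f x) x := (hf.differentiable (by norm_num) x).hasFDerivAt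
    have h2 := (A.hasFDerivAt (x := x)).clm_apply (hasFDerivAt_id x)
    refine (h1.sub (h2.const_mul (1 / 2))).congr_fderiv ?_
    ext v
    simp [hsymm v x]
    ring
  filter_upwards [Metric.ball_mem_nhds (0 : E) hr] with x hx
  have hx' : ‖x‖ < r := by simpa using hx
  have := (convex_closedBall (0 : E) ‖x‖).norm_image_sub_le_of_norm_hasFDerivWithin_le
    (f := fun x => f x - 1 / 2 * A x x) (f' := fun x => fderiv ℝ f x - A x) (C := ε * ‖x‖)
    (x := 0) (y := x)
    (fun z _ => (hder z).hasFDerivWithinAt)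
    (fun z hz => by
      have hz' : ‖z‖ ≤ ‖x‖ := by simpa using hz
      refine (hball z (by simpa using hz'.trans_lt hx')).trans ?_
      gcongr)
    (by simp) (by simp)
  simp [hf0] at this
  simp
  nlinarith [this]

lemma gauss_int {d : ℕ} {m : ℝ} (hm : 0 < m) :
    Integrable (fun y : EuclideanSpace ℝ (Fin d) => Real.exp (-(m * ‖y‖ ^ 2))) := by
  have h := (GaussianFourier.integrable_cexp_neg_mul_sq_norm_add_of_euclideanSpace
    (ι := Fin d) (b := (m : ℂ)) (by simpa using hm) 0 0).norm
  refine h.congr (Eventually.of_forall fun y => ?_)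
  simp only [Complex.norm_exp]
  congr 1
  have : (-(m : ℂ) * (‖y‖ : ℂ) ^ 2 + 0 * ((inner ℝ (0 : EuclideanSpace ℝ (Fin d)) y : ℝ) : ℂ))
      = ((-(m * ‖y‖ ^ 2) : ℝ) : ℂ) := by push_cast; ring
  rw [this, Complex.ofReal_re]


/-- Laplace asymptotics for a `C³` Morse function `f` with minimum `0` at the
origin, nondegenerate (positive definite) Hessian there, cut off by a continuous compactly
supported `ρ` with `0 ≤ ρ ≤ 1`, `ρ ≡ 1` near `0`, and `f > 0` on the support of `ρ` away
from `0`: there is `c > 0` with `t^{d/2} ∫ e^{-t f(x)} ρ(x) dx → c`. -/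
theorem stmt14 {d : ℕ} (hd : 1 ≤ d) (f : EuclideanSpace ℝ (Fin d) → ℝ)
    (hf : ContDiff ℝ 3 f) (hf0 : f 0 = 0) (hdf : fderiv ℝ f 0 = 0)
    (hhess : ∀ v : EuclideanSpace ℝ (Fin d), v ≠ 0 →
      0 < iteratedFDeriv ℝ 2 f 0 ![v, v])
    (ρ : EuclideanSpace ℝ (Fin d) → ℝ) (hρcont : Continuous ρ)
    (hρsupp : HasCompactSupport ρ)
    (hρ0 : ∀ x, 0 ≤ ρ x) (hρ1 : ∀ x, ρ x ≤ 1)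
    (hρone : ∀ᶠ x in nhds (0 : EuclideanSpace ℝ (Fin d)), ρ x = 1)
    (hfpos : ∀ x ∈ tsupport ρ, x ≠ 0 → 0 < f x) :
    ∃ c : ℝ, 0 < c ∧
      Tendsto (fun t : ℝ => t ^ ((d : ℝ) / 2) * ∫ x, Real.exp (-(t * f x)) * ρ x)
        atTop (nhds c) := by
  set A := fderiv ℝ (fderiv ℝ f) 0 with hA
  have hpos : ∀ v, v ≠ 0 → 0 < A v v := by
    intro v hv
    have := hhess v hv
    rwa [iteratedFDeriv_two_apply] at this
  have hAc : Continuous fun v => A v v := by fun_prop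
  -- coercivity of the Hessian
  obtain ⟨a, ha, hAa⟩ : ∃ a, 0 < a ∧ ∀ v, a * ‖v‖ ^ 2 ≤ A v v := by
    obtain ⟨a, ha, h⟩ := (isCompact_sphere (0 : EuclideanSpace ℝ (Fin d)) 1).exists_forall_le'
      hAc.continuousOn (a := 0) (fun v hv => hpos v (by rintro rfl; simp at hv))
    refine ⟨a, ha, fun v => ?_⟩
    by_cases hv : v = 0
    · simp [hv]
    have hn : 0 < ‖v‖ := norm_pos_iff.2 hv
    have h1 := h (‖v‖⁻¹ • v) (by simp [norm_smul, hn.ne'])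
    simp only [map_smul, ContinuousLinearMap.smul_apply, smul_eq_mul] at h1
    have h2 : A v v = (‖v‖⁻¹ * (‖v‖⁻¹ * A v v)) * ‖v‖ ^ 2 := by field_simp
    rw [h2]
    gcongr
  -- quadratic lower bound on the support
  obtain ⟨m, hm, hlow⟩ : ∃ m, 0 < m ∧ ∀ x ∈ tsupport ρ, m * ‖x‖ ^ 2 ≤ f x := by
    obtain ⟨r, hr, hball⟩ := Metric.eventually_nhds_iff_ball.1
      (taylor_two f hf hf0 hdf (ε := a / 4) (by positivity))
    have hK : IsCompact (tsupport ρ \ Metric.ball 0 r) := hρsupp.isCompact.diff Metric.isOpen_ball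
    have hne : ∀ x ∈ tsupport ρ \ Metric.ball 0 r, x ≠ 0 := by
      rintro x ⟨-, hx⟩ rfl
      exact hx (by simpa using hr)
    obtain ⟨b, hb, h⟩ := hK.exists_forall_le' (f := fun x => f x / ‖x‖ ^ 2) (a := 0)
      (hf.continuous.continuousOn.div (by fun_prop) (fun x hx => by simpa using hne x hx))
      (fun x hx => div_pos (hfpos x hx.1 (hne x hx)) (by have := norm_pos_iff.2 (hne x hx); positivity))
    refine ⟨min (a / 4) b, by positivity, fun x hx => ?_⟩
    by_cases hxr : x ∈ Metric.ball 0 r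
    · have h1 := (abs_le.1 (hball x hxr)).1
      have h2 := hAa x
      have h3 : min (a / 4) b * ‖x‖ ^ 2 ≤ a / 4 * ‖x‖ ^ 2 := by gcongr; exact min_le_left _ _
      linarith
    · have hn := norm_pos_iff.2 (hne x ⟨hx, hxr⟩)
      have h1 := h x ⟨hx, hxr⟩
      rw [le_div_iff₀ (by positivity)] at h1
      refine le_trans ?_ h1
      gcongr
      exact min_le_right _ _
  have hGint : Integrable (fun y => Real.exp (-(1 / 2 * A y y))) := by
    refine (gauss_int (d := d) (m := a / 2) (by positivity)).mono'
      (by fun_prop) (Eventually.of_forall fun y => ?_)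
    rw [Real.norm_eq_abs, Real.abs_exp]
    apply Real.exp_le_exp.2
    linarith [hAa y]
  refine ⟨∫ y, Real.exp (-(1 / 2 * A y y)), integral_exp_pos hGint, ?_⟩
  -- the rescaled integrals
  have key : Tendsto (fun t : ℝ => ∫ y, Real.exp (-(t * f ((√t)⁻¹ • y))) * ρ ((√t)⁻¹ • y))
      atTop (nhds (∫ y, Real.exp (-(1 / 2 * A y y)))) := by
    refine tendsto_integral_filter_of_dominated_convergence
      (fun y => Real.exp (-(m * ‖y‖ ^ 2))) ?_ ?_ (gauss_int hm) ?_
    · refine Eventually.of_forall fun t => Continuous.aestronglyMeasurable ?_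
      have := hf.continuous
      fun_prop
    · filter_upwards [eventually_gt_atTop 0] with t ht
      refine Eventually.of_forall fun y => ?_
      rw [Real.norm_eq_abs, abs_mul, Real.abs_exp, abs_of_nonneg (hρ0 _)]
      by_cases hy : (√t)⁻¹ • y ∈ tsupport ρ
      · refine (mul_le_of_le_one_right (Real.exp_pos _).le (hρ1 _)).trans ?_
        apply Real.exp_le_exp.2
        have h1 := mul_le_mul_of_nonneg_left (hlow _ hy) ht.le
        rw [norm_smul, mul_pow, norm_inv, inv_pow, Real.norm_eq_abs, sq_abs,
          Real.sq_sqrt ht.le] at h1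
        have h2 : t * (m * (t⁻¹ * ‖y‖ ^ 2)) = m * ‖y‖ ^ 2 := by field_simp
        linarith
      · rw [image_eq_zero_of_notMem_tsupport hy]
        simp [Real.exp_nonneg]
    · refine Eventually.of_forall fun y => ?_
      have hs : Tendsto (fun t : ℝ => (√t)⁻¹ • y) atTop (nhds 0) := by
        have := (tendsto_inv_atTop_zero.comp Real.tendsto_sqrt_atTop).smul_const y
        simpa using this
      have h1 : Tendsto (fun t : ℝ => t * f ((√t)⁻¹ • y)) atTop (nhds (1 / 2 * A y y)) := by
        rw [Metric.tendsto_nhds]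
        intro ε hε
        filter_upwards [hs.eventually (taylor_two f hf hf0 hdf
          (ε := ε / (‖y‖ ^ 2 + 1)) (by positivity)), eventually_gt_atTop 0] with t h ht
        rw [norm_smul, mul_pow, norm_inv, inv_pow, Real.norm_eq_abs, sq_abs,
          Real.sq_sqrt ht.le] at h
        simp only [map_smul, ContinuousLinearMap.smul_apply, smul_eq_mul] at h
        have hi : (√t)⁻¹ * ((√t)⁻¹ * A y y) = t⁻¹ * A y y := by
          rw [← mul_assoc, ← mul_inv, Real.mul_self_sqrt ht.le]
        rw [← hA, hi] at h
        have h3 : t * f ((√t)⁻¹ • y) - 1 / 2 * A y y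
            = t * (f ((√t)⁻¹ • y) - 1 / 2 * (t⁻¹ * A y y)) := by field_simp
        rw [Real.dist_eq, h3, abs_mul, abs_of_pos ht]
        calc _ ≤ t * (ε / (‖y‖ ^ 2 + 1) * (t⁻¹ * ‖y‖ ^ 2)) := by gcongr
          _ = ε * (‖y‖ ^ 2 / (‖y‖ ^ 2 + 1)) := by field_simp
          _ < ε * 1 := by
            gcongr
            rw [div_lt_one (by positivity)]
            linarith
          _ = ε := mul_one ε
      have h2 : Tendsto (fun t : ℝ => ρ ((√t)⁻¹ • y)) atTop (nhds 1) :=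
        tendsto_const_nhds.congr' ((hs.eventually hρone).mono fun t h => h.symm)
      simpa using ((Real.continuous_exp.tendsto _).comp h1.neg).mul h2
  refine key.congr' ?_
  filter_upwards [eventually_gt_atTop 0] with t ht
  rw [Measure.integral_comp_smul volume (fun x => Real.exp (-(t * f x)) * ρ x) (√t)⁻¹]
  rw [finrank_euclideanSpace_fin, inv_pow, inv_inv, abs_of_nonneg (by positivity), smul_eq_mul]
  congr 1
  rw [Real.sqrt_eq_rpow, ← Real.rpow_natCast, ← Real.rpow_mul ht.le]
  congr 1
  ring
end
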